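/- Let d ≥ 2 be an integer, let (f,g,h) be a triple of bases of ℂ^d, let F=(F₁,F₂,F₃) be a triple of complete flags in ℂ^d in general position, and let r ∈ ℂ/2πiℤ satisfy 3r ≡ Σ_{j∈ℬ} log T^j(F₁,F₂,F₃) (mod 2πiℤ). Then the following are equivalent: (1) (f,g,h) is compatible with ((F₁,F₂,F₃),r); (2) (g,h,f) is compatible with ((F₂,F₃,F₁),r); (3) (h^op,g^op,f^op) is compatible with ((F₃,F₂,F₁),−r), where (x₁,…,x_d)^op := (x_d,…,x₁). (Here one uses that Σ_{j∈ℬ} log T^j is unchanged under a cyclic permutation of the three flags and changes sign under reversing their order, so r and −r satisfy the required congruences for the permuted triples.) -/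

import Mathlib

open scoped BigOperators

/-- A complete flag in `ℂ^d`, recorded by its chain of subspaces
`{0} = F^0 ⊆ F^1 ⊆ ⋯ ⊆ F^d = ℂ^d` with `dim F^k = k` (the values for `k > d` are `⊤`). -/
structure CompleteFlag (d : ℕ) where
  space : ℕ → Submodule ℂ (Fin d → ℂ)
  mono : Monotone space
  finrank_eq : ∀ k, k ≤ d → Module.finrank ℂ (space k) = k
  eq_top : ∀ k, d ≤ k → space k = ⊤

/-- A tuple of complete flags is in general position if
`F₁^{k₁} + ⋯ + F_m^{k_m} = ℂ^d` whenever `k₁ + ⋯ + k_m = d`. -/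
def GenPos {d m : ℕ} (F : Fin m → CompleteFlag d) : Prop :=
  ∀ k : Fin m → ℕ, (∑ i, k i) = d → (⨆ i, (F i).space (k i)) = ⊤

/-- The exterior algebra of `ℂ^d`. -/
abbrev ExtAlg (d : ℕ) := ExteriorAlgebra ℂ (Fin d → ℂ)

/-- The image of `⋀^k (F^k)` inside the exterior algebra of `ℂ^d`. -/
noncomputable def flagPower {d : ℕ} (F : CompleteFlag d) (k : ℕ) : Submodule ℂ (ExtAlg d) :=
  (Submodule.map (ExteriorAlgebra.ι ℂ) (F.space k)) ^ k

/-- The top exterior power `⋀^d (ℂ^d)` inside the exterior algebra. -/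
noncomputable def topPower (d : ℕ) : Submodule ℂ (ExtAlg d) :=
  (LinearMap.range (ExteriorAlgebra.ι ℂ : (Fin d → ℂ) →ₗ[ℂ] ExtAlg d)) ^ d

/-- A linear functional realizing a fixed isomorphism `⋀^d (ℂ^d) ≅ ℂ`,
i.e. injective on the top exterior power. -/
def IsTopIso {d : ℕ} (φ : ExtAlg d →ₗ[ℂ] ℂ) : Prop :=
  ∀ x ∈ topPower d, φ x = 0 → x = 0

/-- A choice, for each `k ≤ d`, of a nonzero element `f^k ∈ ⋀^k (F^k)`. -/
def IsFlagChoice {d : ℕ} (F : CompleteFlag d) (f : ℕ → ExtAlg d) : Prop :=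
  ∀ k, k ≤ d → f k ∈ flagPower F k ∧ f k ≠ 0

/-- A canonical choice of a nonzero element of `⋀^k (F^k)`. -/
noncomputable def flagElt {d : ℕ} (F : CompleteFlag d) (k : ℕ) : ExtAlg d :=
  open scoped Classical in
  if h : ∃ x, x ∈ flagPower F k ∧ x ≠ 0 then h.choose else 0

/-- The triple ratio computed from given choices `f₁, f₂, f₃` of elements. -/
noncomputable def tripleRatioOf {d : ℕ} (φ : ExtAlg d →ₗ[ℂ] ℂ) (f₁ f₂ f₃ : ℕ → ExtAlg d)
    (j : ℕ × ℕ × ℕ) : ℂ :=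
  (φ (f₁ (j.1 + 1) * f₂ j.2.1 * f₃ (j.2.2 - 1)) *
   φ (f₁ j.1 * f₂ (j.2.1 - 1) * f₃ (j.2.2 + 1)) *
   φ (f₁ (j.1 - 1) * f₂ (j.2.1 + 1) * f₃ j.2.2)) /
  (φ (f₁ (j.1 - 1) * f₂ j.2.1 * f₃ (j.2.2 + 1)) *
   φ (f₁ j.1 * f₂ (j.2.1 + 1) * f₃ (j.2.2 - 1)) *
   φ (f₁ (j.1 + 1) * f₂ (j.2.1 - 1) * f₃ j.2.2))

/-- The `j`-triple ratio `T^j(F₁,F₂,F₃)`. -/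
noncomputable def tripleRatio {d : ℕ} (φ : ExtAlg d →ₗ[ℂ] ℂ) (F₁ F₂ F₃ : CompleteFlag d)
    (j : ℕ × ℕ × ℕ) : ℂ :=
  tripleRatioOf φ (flagElt F₁) (flagElt F₂) (flagElt F₃) j

/-- The double ratio computed from given choices of elements. -/
noncomputable def doubleRatioOf {d : ℕ} (φ : ExtAlg d →ₗ[ℂ] ℂ) (g₁ g₂ h₁ h₂ : ℕ → ExtAlg d)
    (i : ℕ × ℕ) : ℂ :=
  -((φ (g₁ i.1 * g₂ (i.2 - 1) * h₁ 1) * φ (g₁ (i.1 - 1) * g₂ i.2 * h₂ 1)) /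
    (φ (g₁ i.1 * g₂ (i.2 - 1) * h₂ 1) * φ (g₁ (i.1 - 1) * g₂ i.2 * h₁ 1)))

/-- The `i`-double ratio `D^i(G₁,G₂,H₁,H₂)`. -/
noncomputable def doubleRatio {d : ℕ} (φ : ExtAlg d →ₗ[ℂ] ℂ) (G₁ G₂ H₁ H₂ : CompleteFlag d)
    (i : ℕ × ℕ) : ℂ :=
  doubleRatioOf φ (flagElt G₁) (flagElt G₂) (flagElt H₁) (flagElt H₂) i

/-- `𝒜`: pairs of positive integers summing to `d`. -/
def Aset (d : ℕ) : Finset (ℕ × ℕ) :=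
  (Finset.range (d + 1) ×ˢ Finset.range (d + 1)).filter
    fun i => 0 < i.1 ∧ 0 < i.2 ∧ i.1 + i.2 = d

/-- `ℬ`: triples of positive integers summing to `d`. -/
def Bset (d : ℕ) : Finset (ℕ × ℕ × ℕ) :=
  (Finset.range (d + 1) ×ˢ Finset.range (d + 1) ×ˢ Finset.range (d + 1)).filter
    fun j => 0 < j.1 ∧ 0 < j.2.1 ∧ 0 < j.2.2 ∧ j.1 + j.2.1 + j.2.2 = d


/-- `v 1, …, v d` is a basis of `ℂ^d` (values of `v` outside `{1, …, d}` are irrelevant). -/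
def IsBasisFam (d : ℕ) (v : ℕ → (Fin d → ℂ)) : Prop :=
  LinearIndependent ℂ (fun i : Fin d => v ((i : ℕ) + 1)) ∧
    Submodule.span ℂ (v '' Set.Icc 1 d) = ⊤

/-- The basis `v 1, …, v d` of `ℂ^d` is adapted to the triple of flags `(F₁, F₂, F₃)`:
`v m ∈ F₁^m ∩ F₃^{d-m+1}` for `1 ≤ m ≤ d` and `v 1 + ⋯ + v d ∈ F₂^1`. -/
def AdaptedBasis {d : ℕ} (F₁ F₂ F₃ : CompleteFlag d) (v : ℕ → (Fin d → ℂ)) : Prop :=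
  IsBasisFam d v ∧
    (∀ m, 1 ≤ m → m ≤ d → v m ∈ F₁.space m ⊓ F₃.space (d - m + 1)) ∧
    (∑ m ∈ Finset.Icc 1 d, v m) ∈ F₂.space 1

/-- The triple of bases `(f, g, h)` is compatible with `((F₁,F₂,F₃), r)`: they are adapted to
`(F₃,F₁,F₂)`, `(F₁,F₂,F₃)`, `(F₂,F₃,F₁)` respectively, `e^{2r} f₁ = g_d` and `e^{2r} g₁ = h_d`. -/
def CompatibleTriple {d : ℕ} (F₁ F₂ F₃ : CompleteFlag d) (r : ℂ)
    (f g h : ℕ → (Fin d → ℂ)) : Prop :=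
  AdaptedBasis F₃ F₁ F₂ f ∧ AdaptedBasis F₁ F₂ F₃ g ∧ AdaptedBasis F₂ F₃ F₁ h ∧
    Complex.exp (2 * r) • f 1 = g d ∧ Complex.exp (2 * r) • g 1 = h d

/-- The reversal `(v_d, …, v_1)` of a `1`-indexed family `(v_1, …, v_d)`. -/
def opFam (d : ℕ) {V : Type*} (v : ℕ → V) : ℕ → V := fun m => v (d + 1 - m)

section ExteriorPowers

open ExteriorAlgebra

variable {K V : Type*} [Field K] [AddCommGroup V] [Module K V]

/-- If a functional vanishes on `W`, contraction with it kills `⋀^n W`. -/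
lemma contractLeft_eq_zero_of_mem_pow {W : Submodule K V} {l : Module.Dual K V}
    (hl : W ≤ LinearMap.ker l) {n : ℕ} {z : ExteriorAlgebra K V}
    (hz : z ∈ (W.map (ι K)) ^ n) : CliffordAlgebra.contractLeft l z = 0 := by
  induction hz using Submodule.pow_induction_on_left' with
  | algebraMap r => exact CliffordAlgebra.contractLeft_algebraMap _ _ _
  | add x y i hx hy ihx ihy => rw [map_add, ihx, ihy, add_zero]
  | mem_mul m hm i x hx ih =>
    obtain ⟨w, hw, rfl⟩ := hm
    have hlw : l w = 0 := hl hw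
    rw [ι, CliffordAlgebra.contractLeft_ι_mul, ih, hlw, zero_smul, mul_zero, sub_zero]

/-- Wedging a nonzero element of `⋀^n W` with a vector outside `W` gives a nonzero element. -/
lemma ι_mul_ne_zero_of_notMem {W : Submodule K V} {v : V} (hv : v ∉ W) {n : ℕ}
    {z : ExteriorAlgebra K V} (hz : z ∈ (W.map (ι K)) ^ n) (hz0 : z ≠ 0) :
    ι K v * z ≠ 0 := by
  obtain ⟨l, hlv, hl⟩ := Submodule.exists_le_ker_of_notMem hv
  intro h
  have h' := congrArg (CliffordAlgebra.contractLeft l) h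
  rw [ι, CliffordAlgebra.contractLeft_ι_mul, contractLeft_eq_zero_of_mem_pow hl hz, map_zero,
    mul_zero, sub_zero] at h'
  exact (smul_ne_zero hlv hz0) h'

/-- A vector commutes with an element of `⋀^n W` up to the sign `(-1)^n`. -/
lemma mul_ι_eq_neg_one_pow_smul {W : Submodule K V} (v : V) {n : ℕ}
    {z : ExteriorAlgebra K V} (hz : z ∈ (W.map (ι K)) ^ n) :
    z * ι K v = (-1 : K) ^ n • (ι K v * z) := by
  induction hz using Submodule.pow_induction_on_left' with
  | algebraMap r => rw [pow_zero, one_smul, Algebra.commutes]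
  | add x y i hx hy ihx ihy => rw [add_mul, mul_add, ihx, ihy, smul_add]
  | mem_mul m hm i x hx ih =>
    obtain ⟨w, hw, rfl⟩ := hm
    rw [mul_assoc, ih, mul_smul_comm, ← mul_assoc, ← mul_assoc,
      eq_neg_of_add_eq_zero_left (ι_add_mul_swap w v), pow_succ]
    simp

/-- `⋀^n W` is the image of the `n`-th exterior power of the vector space `W`. -/
lemma map_ι_pow_eq_map_exteriorPower (W : Submodule K V) (n : ℕ) :
    (W.map (ι K)) ^ n = (⋀[K]^n W).map (ExteriorAlgebra.map W.subtype).toLinearMap := by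
  rw [exteriorPower, Submodule.map_pow, ι_range_map_map, Submodule.range_subtype]

instance finite_map_ι_pow [FiniteDimensional K V] (W : Submodule K V) (n : ℕ) :
    Module.Finite K ↥((W.map (ι K)) ^ n) := by
  rw [map_ι_pow_eq_map_exteriorPower]
  infer_instance

lemma finrank_map_ι_pow_le [FiniteDimensional K V] (W : Submodule K V) (n : ℕ) :
    Module.finrank K ↥((W.map (ι K)) ^ n) ≤ (Module.finrank K W).choose n := by
  rw [map_ι_pow_eq_map_exteriorPower, ← exteriorPower.finrank_eq]
  exact Submodule.finrank_map_le _ _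

lemma exists_smul_eq_of_mem_map_ι_pow [FiniteDimensional K V] {W : Submodule K V} {n : ℕ}
    (hW : Module.finrank K W = n) {x y : ExteriorAlgebra K V} (hx : x ∈ (W.map (ι K)) ^ n)
    (hx0 : x ≠ 0) (hy : y ∈ (W.map (ι K)) ^ n) : ∃ c : K, y = c • x := by
  have h1 : Module.finrank K ↥((W.map (ι K)) ^ n) = 1 := by
    refine le_antisymm ((finrank_map_ι_pow_le W n).trans (by simp [hW])) ?_
    exact Module.finrank_pos_iff_exists_ne_zero.mpr ⟨⟨x, hx⟩, by simpa using hx0⟩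
  obtain ⟨c, hc⟩ := exists_smul_eq_of_finrank_eq_one h1 (x := ⟨x, hx⟩) (by simpa using hx0) ⟨y, hy⟩
  exact ⟨c, (congrArg Subtype.val hc).symm⟩

lemma ι_mul_eq_zero_of_mem [FiniteDimensional K V] {W : Submodule K V} {n : ℕ}
    (hW : Module.finrank K W = n) {w : V} (hw : w ∈ W) {x : ExteriorAlgebra K V}
    (hx : x ∈ (W.map (ι K)) ^ n) : ι K w * x = 0 := by
  have hmem : ι K w * x ∈ (W.map (ι K)) ^ (n + 1) := by
    rw [pow_succ']
    exact Submodule.mul_mem_mul (Submodule.mem_map_of_mem hw) hx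
  have h0 : Module.finrank K ↥((W.map (ι K)) ^ (n + 1)) = 0 :=
    Nat.le_zero.mp ((finrank_map_ι_pow_le W (n + 1)).trans (by simp [hW]))
  rwa [Submodule.finrank_eq_zero.mp h0, Submodule.mem_bot] at hmem

lemma mul_mem_map_ι_sup_pow {W U : Submodule K V} {m n : ℕ} {x y : ExteriorAlgebra K V}
    (hx : x ∈ (W.map (ι K)) ^ m) (hy : y ∈ (U.map (ι K)) ^ n) :
    x * y ∈ ((W ⊔ U).map (ι K)) ^ (m + n) := by
  rw [pow_add]
  exact Submodule.mul_mem_mul (pow_le_pow_left' (Submodule.map_mono le_sup_left) m hx)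
    (pow_le_pow_left' (Submodule.map_mono le_sup_right) n hy)

end ExteriorPowers

namespace CompleteFlag

open ExteriorAlgebra

variable {d : ℕ}

lemma exists_mem_notMem (F : CompleteFlag d) {k : ℕ} (hk : k < d) :
    ∃ v ∈ F.space (k + 1), v ∉ F.space k := by
  by_contra! h
  have := Submodule.finrank_mono (R := ℂ) (show F.space (k + 1) ≤ F.space k from h)
  rw [F.finrank_eq _ hk, F.finrank_eq _ hk.le] at this
  omega

lemma ι_mul_mem_flagPower (F : CompleteFlag d) {k : ℕ} {v : Fin d → ℂ} {q : ExtAlg d}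
    (hv : v ∈ F.space (k + 1)) (hq : q ∈ flagPower F k) : ι ℂ v * q ∈ flagPower F (k + 1) := by
  rw [flagPower, pow_succ']
  exact Submodule.mul_mem_mul (Submodule.mem_map_of_mem hv)
    (pow_le_pow_left' (Submodule.map_mono (F.mono k.le_succ)) k hq)

lemma exists_mem_flagPower_ne_zero (F : CompleteFlag d) {k : ℕ} (hk : k ≤ d) :
    ∃ x ∈ flagPower F k, x ≠ 0 := by
  induction k with
  | zero => exact ⟨1, by simp [flagPower], one_ne_zero⟩
  | succ k ih =>
    obtain ⟨q, hq, hq0⟩ := ih (by omega)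
    obtain ⟨v, hv, hv'⟩ := F.exists_mem_notMem hk
    exact ⟨_, F.ι_mul_mem_flagPower hv hq, ι_mul_ne_zero_of_notMem hv' hq hq0⟩

/-- The canonical choice `flagElt F` is a choice of nonzero elements. -/
lemma isFlagChoice_flagElt (F : CompleteFlag d) : IsFlagChoice F (flagElt F) := by
  intro k hk
  have h := F.exists_mem_flagPower_ne_zero hk
  rw [flagElt, dif_pos h]
  exact h.choose_spec

lemma mul_ne_zero_of_disjoint (F : CompleteFlag d) {U : Submodule ℂ (Fin d → ℂ)} {k m : ℕ}
    (hk : k ≤ d) (hU : Disjoint (F.space k) U) {x y : ExtAlg d} (hx : x ∈ flagPower F k)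
    (hx0 : x ≠ 0) (hy : y ∈ (U.map (ι ℂ)) ^ m) (hy0 : y ≠ 0) : x * y ≠ 0 := by
  induction k generalizing x with
  | zero =>
    rw [flagPower, pow_zero, Submodule.mem_one] at hx
    obtain ⟨c, rfl⟩ := hx
    rw [← Algebra.smul_def]
    exact smul_ne_zero (fun hc => hx0 (by rw [hc, map_zero])) hy0
  | succ k ih =>
    obtain ⟨q, hq, hq0⟩ := F.exists_mem_flagPower_ne_zero (k := k) (by omega)
    obtain ⟨v, hv, hv'⟩ := F.exists_mem_notMem hk
    obtain ⟨c, rfl⟩ := exists_smul_eq_of_mem_map_ι_pow (F.finrank_eq _ hk)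
      (F.ι_mul_mem_flagPower hv hq) (ι_mul_ne_zero_of_notMem hv' hq hq0) hx
    rw [smul_mul_assoc, mul_assoc]
    refine smul_ne_zero (left_ne_zero_of_smul hx0) (ι_mul_ne_zero_of_notMem ?_
      (mul_mem_map_ι_sup_pow hq hy) (ih (by omega) (hU.mono_left (F.mono k.le_succ)) hq hq0))
    intro hvs
    obtain ⟨w, hw, u, hu, rfl⟩ := Submodule.mem_sup.mp hvs
    have hu' : u ∈ F.space (k + 1) :=
      (Submodule.add_mem_iff_right _ (F.mono k.le_succ hw)).mp hv
    rw [Submodule.disjoint_def.mp hU u hu' hu, add_zero] at hv'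
    exact hv' hw

end CompleteFlag

section Telescoping

lemma Finset.prod_range_div_of_ne_zero {K : Type*} [Field K] (u : ℕ → K) (n : ℕ)
    (hu : ∀ i ≤ n, u i ≠ 0) : ∏ i ∈ Finset.range n, u (i + 1) / u i = u n / u 0 := by
  induction n with
  | zero => simp [hu 0 le_rfl]
  | succ n ih =>
    have hn := hu n n.le_succ
    rw [Finset.prod_range_succ, ih fun i hi => hu i (hi.trans n.le_succ)]
    field_simp

lemma prod_Bset_eq {M : Type*} [CommMonoid M] (N : ℕ) (T : ℕ × ℕ × ℕ → M) :
    ∏ j ∈ Bset (N + 2), T j =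
      ∏ k ∈ Finset.range N, ∏ i ∈ Finset.range (N - k), T (i + 1, N - k - i, k + 1) := by
  rw [Finset.prod_sigma']
  refine Finset.prod_nbij' (fun j => ⟨j.2.2 - 1, j.1 - 1⟩)
    (fun p => (p.2 + 1, N - p.1 - p.2, p.1 + 1)) ?_ ?_ ?_ ?_ ?_
  · rintro ⟨a, b, c⟩ h
    simp only [Bset, Finset.mem_filter, Finset.mem_product, Finset.mem_range, Finset.mem_sigma] at *
    omega
  · rintro ⟨k, i⟩ h
    simp only [Bset, Finset.mem_filter, Finset.mem_product, Finset.mem_range, Finset.mem_sigma] at *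
    omega
  · rintro ⟨a, b, c⟩ h
    simp only [Bset, Finset.mem_filter, Finset.mem_product, Finset.mem_range, Prod.mk.injEq] at *
    omega
  · rintro ⟨k, i⟩ h
    simp
  · rintro ⟨a, b, c⟩ h
    simp only [Bset, Finset.mem_filter, Finset.mem_product, Finset.mem_range] at h
    congr 1
    simp only [Prod.mk.injEq]
    omega

/-- The product over `ℬ` of the triple ratios of a nowhere vanishing function on the discrete
triangle of size `d = N + 2` telescopes to a product of six values next to the corners. -/
lemma prod_Bset_hexagon_ratio {K : Type*} [Field K] (N : ℕ) (D : ℕ → ℕ → ℕ → K)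
    (hD : ∀ a b c, a + b + c = N + 2 → D a b c ≠ 0) :
    ∏ j ∈ Bset (N + 2),
      (D (j.1 + 1) j.2.1 (j.2.2 - 1) * D j.1 (j.2.1 - 1) (j.2.2 + 1) *
        D (j.1 - 1) (j.2.1 + 1) j.2.2) /
      (D (j.1 - 1) j.2.1 (j.2.2 + 1) * D j.1 (j.2.1 + 1) (j.2.2 - 1) *
        D (j.1 + 1) (j.2.1 - 1) j.2.2) =
      (D (N + 1) 1 0 * D 0 (N + 1) 1 * D 1 0 (N + 1)) /
        (D (N + 1) 0 1 * D 1 (N + 1) 0 * D 0 1 (N + 1)) := by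
  let V : ℕ → K := fun k => D (N + 1 - k) 0 (k + 1) * D 1 (N + 1 - k) k /
    (D 0 (N + 1 - k) (k + 1) * D (N + 1 - k) 1 k)
  have hV : ∀ k ≤ N, V k ≠ 0 := by
    intro k hk
    refine div_ne_zero (mul_ne_zero ?_ ?_) (mul_ne_zero ?_ ?_) <;> exact hD _ _ _ (by omega)
  have hrow : ∀ k ∈ Finset.range N, ∏ i ∈ Finset.range (N - k),
      (D (i + 2) (N - k - i) k * D (i + 1) (N - k - i - 1) (k + 2) *
        D i (N - k - i + 1) (k + 1)) /
      (D i (N - k - i) (k + 2) * D (i + 1) (N - k - i + 1) k *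
        D (i + 2) (N - k - i - 1) (k + 1)) = V (k + 1) / V k := by
    intro k hk
    rw [Finset.mem_range] at hk
    obtain ⟨m, hm, hm0⟩ : ∃ m, N = k + m ∧ 0 < m := ⟨N - k, by omega, by omega⟩
    let u : ℕ → K := fun i => D (i + 1) (m - i + 1) k * D i (m - i) (k + 2) /
      (D i (m - i + 1) (k + 1) * D (i + 1) (m - i) (k + 1))
    have hu : ∀ i ≤ m, u i ≠ 0 := by
      intro i hi
      refine div_ne_zero (mul_ne_zero ?_ ?_) (mul_ne_zero ?_ ?_) <;> exact hD _ _ _ (by omega)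
    have hkm : N - k = m := by omega
    have hterm : ∀ i ∈ Finset.range m,
        (D (i + 2) (m - i) k * D (i + 1) (m - i - 1) (k + 2) * D i (m - i + 1) (k + 1)) /
        (D i (m - i) (k + 2) * D (i + 1) (m - i + 1) k * D (i + 2) (m - i - 1) (k + 1)) =
        u (i + 1) / u i := by
      intro i hi
      rw [Finset.mem_range] at hi
      have e1 : m - i - 1 + 1 = m - i := by omega
      have e2 : m - (i + 1) = m - i - 1 := by omega
      simp only [u, e2, e1]
      have h1 := hD (i + 1) (m - i) (k + 1) (by omega)
      have h2 := hD (i + 1) (m - i + 1) k (by omega)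
      have h3 := hD i (m - i) (k + 2) (by omega)
      have h4 := hD i (m - i + 1) (k + 1) (by omega)
      have h5 := hD (i + 2) (m - i - 1) (k + 1) (by omega)
      field_simp
    rw [hkm, Finset.prod_congr rfl hterm, Finset.prod_range_div_of_ne_zero u m hu]
    have e1 : N + 1 - k = m + 1 := by omega
    have e2 : N + 1 - (k + 1) = m := by omega
    simp only [u, V, e1, e2, Nat.sub_self, Nat.sub_zero, zero_add]
    have h1 := hD 0 (m + 1) (k + 1) (by omega)
    have h2 := hD 1 m (k + 1) (by omega)
    have h3 := hD m 1 (k + 1) (by omega)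
    have h4 := hD (m + 1) 0 (k + 1) (by omega)
    have h5 := hD 1 (m + 1) k (by omega)
    have h6 := hD 0 m (k + 2) (by omega)
    have h7 := hD (m + 1) 1 k (by omega)
    field_simp
  rw [prod_Bset_eq]
  refine (Finset.prod_congr rfl hrow).trans ?_
  rw [Finset.prod_range_div_of_ne_zero V N hV]
  have e1 : N + 1 - N = 1 := by omega
  simp only [V, e1, Nat.sub_zero, zero_add]
  have h1 := hD 1 1 N (by omega)
  have h2 := hD 0 1 (N + 1) (by omega)
  have h3 := hD 0 (N + 1) 1 (by omega)
  have h4 := hD (N + 1) 1 0 (by omega)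
  have h5 := hD (N + 1) 0 1 (by omega)
  have h6 := hD 1 (N + 1) 0 (by omega)
  field_simp

end Telescoping

section FlagTriples

open ExteriorAlgebra

variable {d : ℕ}

lemma flagPower_le_pow_range (F : CompleteFlag d) (k : ℕ) :
    flagPower F k ≤ (LinearMap.range (ι ℂ : (Fin d → ℂ) →ₗ[ℂ] ExtAlg d)) ^ k :=
  pow_le_pow_left' (LinearMap.map_le_range) k

lemma GenPos.sup_eq_top {F₁ F₂ F₃ : CompleteFlag d} (hF : GenPos ![F₁, F₂, F₃]) {a b c : ℕ}
    (habc : a + b + c = d) : F₁.space a ⊔ F₂.space b ⊔ F₃.space c = ⊤ := by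
  have h := hF ![a, b, c] (by simp [Fin.sum_univ_three, habc])
  rw [iSup_fin_three] at h
  simpa using h

/-- The wedge of flag elements of complementary degrees is nonzero in general position. -/
lemma GenPos.wedge_ne_zero {F₁ F₂ F₃ : CompleteFlag d} (hF : GenPos ![F₁, F₂, F₃])
    {φ : ExtAlg d →ₗ[ℂ] ℂ} (hφ : IsTopIso φ) {a b c : ℕ} (habc : a + b + c = d)
    {x y z : ExtAlg d} (hx : x ∈ flagPower F₁ a) (hx0 : x ≠ 0) (hy : y ∈ flagPower F₂ b)
    (hy0 : y ≠ 0) (hz : z ∈ flagPower F₃ c) (hz0 : z ≠ 0) : φ (x * y * z) ≠ 0 := by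
  have htop := hF.sup_eq_top habc
  have ha := F₁.finrank_eq a (by omega)
  have hb := F₂.finrank_eq b (by omega)
  have hc := F₃.finrank_eq c (by omega)
  have hd : Module.finrank ℂ (⊤ : Submodule ℂ (Fin d → ℂ)) = d := by simp
  rw [← htop] at hd
  have h1 := Submodule.finrank_sup_add_finrank_inf_eq (F₁.space a) (F₂.space b ⊔ F₃.space c)
  have h2 := Submodule.finrank_sup_add_finrank_inf_eq (F₂.space b) (F₃.space c)
  rw [← sup_assoc] at h1
  have d1 : Disjoint (F₁.space a) (F₂.space b ⊔ F₃.space c) := by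
    rw [disjoint_iff, ← Submodule.finrank_eq_zero (R := ℂ)]
    omega
  have d2 : Disjoint (F₂.space b) (F₃.space c) := by
    rw [disjoint_iff, ← Submodule.finrank_eq_zero (R := ℂ)]
    omega
  have hyz := F₂.mul_ne_zero_of_disjoint (by omega) d2 hy hy0 hz hz0
  have hxyz := F₁.mul_ne_zero_of_disjoint (by omega) d1 hx hx0
    (mul_mem_map_ι_sup_pow hy hz) hyz
  rw [mul_assoc]
  refine fun h => hxyz (hφ _ ?_ h)
  have hpow : topPower d = LinearMap.range (ι ℂ) ^ a *
      (LinearMap.range (ι ℂ) ^ b * LinearMap.range (ι ℂ) ^ c) := by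
    rw [← pow_add, ← pow_add, ← add_assoc, habc, topPower]
  rw [hpow]
  exact Submodule.mul_mem_mul (flagPower_le_pow_range _ _ hx)
    (Submodule.mul_mem_mul (flagPower_le_pow_range _ _ hy) (flagPower_le_pow_range _ _ hz))

lemma CompleteFlag.exists_ι_eq_flagElt_one (F : CompleteFlag d) (hd : 1 ≤ d) :
    ∃ p ∈ F.space 1, p ≠ 0 ∧ ι ℂ p = flagElt F 1 := by
  obtain ⟨h, h0⟩ := F.isFlagChoice_flagElt 1 hd
  rw [flagPower, pow_one] at h
  obtain ⟨p, hp, hpe⟩ := h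
  exact ⟨p, hp, fun h => h0 (by rw [← hpe, h, map_zero]), hpe⟩

lemma CompleteFlag.exists_flagElt_zero_eq (F : CompleteFlag d) :
    ∃ c : ℂ, c ≠ 0 ∧ flagElt F 0 = algebraMap ℂ _ c := by
  obtain ⟨h, h0⟩ := F.isFlagChoice_flagElt 0 (Nat.zero_le d)
  rw [flagPower, pow_zero, Submodule.mem_one] at h
  obtain ⟨c, hc⟩ := h
  exact ⟨c, fun h => h0 (by rw [← hc, h, map_zero]), hc.symm⟩

lemma CompleteFlag.exists_smul_eq_of_mem_one (F : CompleteFlag d) (hd : 1 ≤ d)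
    {p v : Fin d → ℂ} (hp : p ∈ F.space 1) (hp0 : p ≠ 0) (hv : v ∈ F.space 1) :
    ∃ c : ℂ, v = c • p := by
  obtain ⟨c, hc⟩ := exists_smul_eq_of_finrank_eq_one (F.finrank_eq 1 hd) (x := ⟨p, hp⟩)
    (by simpa using hp0) ⟨v, hv⟩
  exact ⟨c, (congrArg Subtype.val hc).symm⟩

/-- For a basis `g` adapted to `(F₁, F₂, F₃)`, the ratio of the coordinates of `g_d` and `g_1`
with respect to generators of `F₃^1` and `F₁^1` is determined by wedge products of flag elements. -/
lemma AdaptedBasis.exists_coords {N : ℕ} {F₁ F₂ F₃ : CompleteFlag (N + 1)}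
    {g : ℕ → (Fin (N + 1) → ℂ)} (hg : AdaptedBasis F₁ F₂ F₃ g) (φ : ExtAlg (N + 1) →ₗ[ℂ] ℂ)
    {p₁ p₂ p₃ : Fin (N + 1) → ℂ} (hp₁ : p₁ ∈ F₁.space 1) (hp₁' : p₁ ≠ 0)
    (hp₂ : p₂ ∈ F₂.space 1) (hp₂' : p₂ ≠ 0) (hp₃ : p₃ ∈ F₃.space 1) (hp₃' : p₃ ≠ 0)
    {x z : ExtAlg (N + 1)} (hx : x ∈ flagPower F₁ N) (hz : z ∈ flagPower F₃ N) :
    ∃ A B : ℂ, A ≠ 0 ∧ g 1 = A • p₁ ∧ g (N + 1) = B • p₃ ∧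
      B * (φ (ι ℂ p₃ * x) * φ (ι ℂ p₂ * z)) = A * (φ (ι ℂ p₁ * z) * φ (ι ℂ p₂ * x)) := by
  obtain ⟨⟨hli, -⟩, hmem, hsum⟩ := hg
  have hg1 : g 1 ≠ 0 := by simpa using hli.ne_zero 0
  obtain ⟨A, hA⟩ := F₁.exists_smul_eq_of_mem_one (by omega) hp₁ hp₁' (hmem 1 le_rfl (by omega)).1
  obtain ⟨B, hB⟩ := F₃.exists_smul_eq_of_mem_one (by omega) hp₃ hp₃'
    (by simpa using (hmem (N + 1) (by omega) le_rfl).2)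
  obtain ⟨s, hs⟩ := F₂.exists_smul_eq_of_mem_one (by omega) hp₂ hp₂' hsum
  have hz' : s * φ (ι ℂ p₂ * z) = A * φ (ι ℂ p₁ * z) := by
    have h : ι ℂ (∑ m ∈ Finset.Icc 1 (N + 1), g m) * z = ι ℂ (g 1) * z := by
      rw [map_sum, Finset.sum_mul]
      refine Finset.sum_eq_single_of_mem 1 (by simp) fun m hm hm1 => ?_
      rw [Finset.mem_Icc] at hm
      exact ι_mul_eq_zero_of_mem (F₃.finrank_eq N (by omega))
        (F₃.mono (by omega) (hmem m hm.1 hm.2).2) hz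
    rw [hs, hA] at h
    simpa using congrArg φ h
  have hx' : s * φ (ι ℂ p₂ * x) = B * φ (ι ℂ p₃ * x) := by
    have h : ι ℂ (∑ m ∈ Finset.Icc 1 (N + 1), g m) * x = ι ℂ (g (N + 1)) * x := by
      rw [map_sum, Finset.sum_mul]
      refine Finset.sum_eq_single_of_mem (N + 1) (by simp) fun m hm hm1 => ?_
      rw [Finset.mem_Icc] at hm
      exact ι_mul_eq_zero_of_mem (F₁.finrank_eq N (by omega))
        (F₁.mono (by omega) (hmem m hm.1 hm.2).1) hx
    rw [hs, hB] at h
    simpa using congrArg φ h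
  refine ⟨A, B, ?_, hA, hB, ?_⟩
  · rintro rfl
    exact hg1 (by rw [hA, zero_smul])
  · linear_combination φ (ι ℂ p₂ * x) * hz' - φ (ι ℂ p₂ * z) * hx'

/-- The square of the product of all triple ratios, in terms of wedges of lines and hyperplanes. -/
lemma prod_tripleRatio_sq {N : ℕ} {φ : ExtAlg (N + 2) →ₗ[ℂ] ℂ} (hφ : IsTopIso φ)
    {F₁ F₂ F₃ : CompleteFlag (N + 2)} (hF : GenPos ![F₁, F₂, F₃]) :
    let δ : CompleteFlag (N + 2) → CompleteFlag (N + 2) → ℂ :=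
      fun F G => φ (flagElt F 1 * flagElt G (N + 1))
    δ F₃ F₁ * δ F₂ F₃ * δ F₁ F₂ ≠ 0 ∧
      (∏ j ∈ Bset (N + 2), tripleRatio φ F₁ F₂ F₃ j) ^ 2 * (δ F₃ F₁ * δ F₂ F₃ * δ F₁ F₂) ^ 2 =
        (δ F₁ F₃ * δ F₂ F₁ * δ F₃ F₂) ^ 2 := by
  intro δ
  let D : ℕ → ℕ → ℕ → ℂ := fun a b c => φ (flagElt F₁ a * flagElt F₂ b * flagElt F₃ c)
  have hD : ∀ a b c, a + b + c = N + 2 → D a b c ≠ 0 := fun a b c h =>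
    have h₁ := F₁.isFlagChoice_flagElt a (by omega)
    have h₂ := F₂.isFlagChoice_flagElt b (by omega)
    have h₃ := F₃.isFlagChoice_flagElt c (by omega)
    hF.wedge_ne_zero hφ h h₁.1 h₁.2 h₂.1 h₂.2 h₃.1 h₃.2
  have hP : ∏ j ∈ Bset (N + 2), tripleRatio φ F₁ F₂ F₃ j =
      (D (N + 1) 1 0 * D 0 (N + 1) 1 * D 1 0 (N + 1)) /
        (D (N + 1) 0 1 * D 1 (N + 1) 0 * D 0 1 (N + 1)) := prod_Bset_hexagon_ratio N D hD
  have hswap : ∀ F G : CompleteFlag (N + 2),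
      flagElt G (N + 1) * flagElt F 1 =
        (-1 : ℂ) ^ (N + 1) • (flagElt F 1 * flagElt G (N + 1)) := by
    intro F G
    obtain ⟨p, -, -, hp⟩ := F.exists_ι_eq_flagElt_one (by omega)
    rw [← hp]
    exact mul_ι_eq_neg_one_pow_smul p (G.isFlagChoice_flagElt (N + 1) (by omega)).1
  obtain ⟨c₁, hc₁, h₁⟩ := F₁.exists_flagElt_zero_eq
  obtain ⟨c₂, hc₂, h₂⟩ := F₂.exists_flagElt_zero_eq
  obtain ⟨c₃, hc₃, h₃⟩ := F₃.exists_flagElt_zero_eq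
  have e1 : D (N + 1) 1 0 = (-1) ^ (N + 1) * c₃ * δ F₂ F₁ := by
    simp [D, δ, h₃, hswap, ← Algebra.commutes, ← Algebra.smul_def]
    ring
  have e2 : D 0 (N + 1) 1 = (-1) ^ (N + 1) * c₁ * δ F₃ F₂ := by
    simp [D, δ, h₁, hswap, mul_assoc, ← Algebra.smul_def]
  have e3 : D 1 0 (N + 1) = c₂ * δ F₁ F₃ := by
    simp [D, δ, h₂, ← Algebra.commutes, ← Algebra.smul_def]
  have e4 : D (N + 1) 0 1 = (-1) ^ (N + 1) * c₂ * δ F₃ F₁ := by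
    simp [D, δ, h₂, hswap, ← Algebra.commutes, ← Algebra.smul_def]
    ring
  have e5 : D 1 (N + 1) 0 = c₃ * δ F₁ F₂ := by
    simp [D, δ, h₃, ← Algebra.commutes, ← Algebra.smul_def]
  have e6 : D 0 1 (N + 1) = c₁ * δ F₂ F₃ := by
    simp [D, δ, h₁, mul_assoc, ← Algebra.smul_def]
  have h31 := right_ne_zero_of_mul (e4 ▸ hD (N + 1) 0 1 (by omega))
  have h12 := right_ne_zero_of_mul (e5 ▸ hD 1 (N + 1) 0 (by omega))
  have h23 := right_ne_zero_of_mul (e6 ▸ hD 0 1 (N + 1) (by omega))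
  refine ⟨mul_ne_zero (mul_ne_zero h31 h23) h12, ?_⟩
  have hsign : (((-1 : ℂ)) ^ (N + 1)) ^ 2 = 1 := by rw [← pow_mul, mul_comm, pow_mul]; simp
  have hs0 : ((-1 : ℂ)) ^ (N + 1) ≠ 0 := pow_ne_zero _ (by simp)
  rw [hP, e1, e2, e3, e4, e5, e6]
  generalize (-1 : ℂ) ^ (N + 1) = s at *
  field_simp
  rw [hsign]
  ring

/-- The monodromy around a triangle of flags in general position: the product of the ratios
`g_d / f_1`, `h_d / g_1`, `f_d / h_1` is the square of the product of the triple ratios. -/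
lemma exists_coords_of_adaptedBasis {N : ℕ} {φ : ExtAlg (N + 2) →ₗ[ℂ] ℂ} (hφ : IsTopIso φ)
    {F₁ F₂ F₃ : CompleteFlag (N + 2)} (hF : GenPos ![F₁, F₂, F₃])
    {f g h : ℕ → (Fin (N + 2) → ℂ)} (hf : AdaptedBasis F₃ F₁ F₂ f)
    (hg : AdaptedBasis F₁ F₂ F₃ g) (hh : AdaptedBasis F₂ F₃ F₁ h) :
    ∃ (p₁ p₂ p₃ : Fin (N + 2) → ℂ) (A₁ A₂ A₃ B₁ B₂ B₃ : ℂ),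
      p₁ ≠ 0 ∧ p₂ ≠ 0 ∧ p₃ ≠ 0 ∧ A₁ ≠ 0 ∧ A₂ ≠ 0 ∧ A₃ ≠ 0 ∧
      f 1 = A₃ • p₃ ∧ g (N + 2) = B₃ • p₃ ∧ g 1 = A₁ • p₁ ∧ h (N + 2) = B₁ • p₁ ∧
      h 1 = A₂ • p₂ ∧ f (N + 2) = B₂ • p₂ ∧
      B₁ * B₂ * B₃ =
        (∏ j ∈ Bset (N + 2), tripleRatio φ F₁ F₂ F₃ j) ^ 2 * (A₁ * A₂ * A₃) := by
  obtain ⟨p₁, hp₁, hp₁', e₁⟩ := F₁.exists_ι_eq_flagElt_one (by omega)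
  obtain ⟨p₂, hp₂, hp₂', e₂⟩ := F₂.exists_ι_eq_flagElt_one (by omega)
  obtain ⟨p₃, hp₃, hp₃', e₃⟩ := F₃.exists_ι_eq_flagElt_one (by omega)
  have hx₁ := (F₁.isFlagChoice_flagElt (N + 1) (by omega)).1
  have hx₂ := (F₂.isFlagChoice_flagElt (N + 1) (by omega)).1
  have hx₃ := (F₃.isFlagChoice_flagElt (N + 1) (by omega)).1
  obtain ⟨A₃, B₂, hA₃, hfA, hfB, hfe⟩ :=
    hf.exists_coords φ hp₃ hp₃' hp₁ hp₁' hp₂ hp₂' hx₃ hx₂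
  obtain ⟨A₁, B₃, hA₁, hgA, hgB, hge⟩ :=
    hg.exists_coords φ hp₁ hp₁' hp₂ hp₂' hp₃ hp₃' hx₁ hx₃
  obtain ⟨A₂, B₁, hA₂, hhA, hhB, hhe⟩ :=
    hh.exists_coords φ hp₂ hp₂' hp₃ hp₃' hp₁ hp₁' hx₂ hx₁
  obtain ⟨hne, hP⟩ := prod_tripleRatio_sq hφ hF
  simp only [e₁, e₂, e₃] at hfe hge hhe
  refine ⟨p₁, p₂, p₃, A₁, A₂, A₃, B₁, B₂, B₃, hp₁', hp₂', hp₃', hA₁, hA₂, hA₃, hfA, hgB, hgA,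
    hhB, hhA, hfB, mul_right_cancel₀ (pow_ne_zero 2 hne) ?_⟩
  have hprod := congrArg₂ (· * ·) (congrArg₂ (· * ·) hge hhe) hfe
  linear_combination hprod - A₁ * A₂ * A₃ * hP

end FlagTriples

section Reversal

variable {d : ℕ}

lemma opFam_image_Icc {V : Type*} (v : ℕ → V) :
    opFam d v '' Set.Icc 1 d = v '' Set.Icc 1 d := by
  ext x
  constructor <;> rintro ⟨m, hm, rfl⟩ <;> rw [Set.mem_Icc] at hm
  · exact ⟨d + 1 - m, by rw [Set.mem_Icc]; omega, rfl⟩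
  · exact ⟨d + 1 - m, by rw [Set.mem_Icc]; omega, congrArg v (by omega)⟩

lemma sum_opFam {V : Type*} [AddCommMonoid V] (v : ℕ → V) :
    ∑ m ∈ Finset.Icc 1 d, opFam d v m = ∑ m ∈ Finset.Icc 1 d, v m := by
  refine Finset.sum_nbij' (fun m => d + 1 - m) (fun m => d + 1 - m) ?_ ?_ ?_ ?_ fun _ _ => rfl
  all_goals
    intro m hm
    simp only [Finset.mem_Icc] at *
    omega

lemma isBasisFam_opFam {v : ℕ → (Fin d → ℂ)} : IsBasisFam d (opFam d v) ↔ IsBasisFam d v := by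
  have h : (fun i : Fin d => opFam d v ((i : ℕ) + 1)) =
      (fun i : Fin d => v ((i : ℕ) + 1)) ∘ Fin.revPerm := by
    funext i
    simp only [opFam, Function.comp, Fin.revPerm_apply, Fin.val_rev]
    congr 1
    omega
  rw [IsBasisFam, IsBasisFam, opFam_image_Icc, h, linearIndependent_equiv]

/-- Reversing a basis exchanges the outer flags of the triple it is adapted to. -/
lemma adaptedBasis_opFam {F₁ F₂ F₃ : CompleteFlag d} {v : ℕ → (Fin d → ℂ)} :
    AdaptedBasis F₃ F₂ F₁ (opFam d v) ↔ AdaptedBasis F₁ F₂ F₃ v := by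
  rw [AdaptedBasis, AdaptedBasis, isBasisFam_opFam, sum_opFam]
  refine and_congr_right fun _ => and_congr_left fun _ => ⟨fun h m h1 h2 => ?_, fun h m h1 h2 => ?_⟩
  · have := h (d + 1 - m) (by omega) (by omega)
    rwa [opFam, show d + 1 - (d + 1 - m) = m by omega, show d - (d + 1 - m) + 1 = m by omega,
      show d + 1 - m = d - m + 1 by omega, inf_comm] at this
  · have := h (d + 1 - m) (by omega) (by omega)
    rwa [show d - (d + 1 - m) + 1 = m by omega, inf_comm,
      show F₁.space (d + 1 - m) = F₁.space (d - m + 1) by congr 1; omega] at this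

end Reversal

lemma exp_neg_smul_eq_iff {V : Type*} [AddCommGroup V] [Module ℂ V] (z : ℂ) (v w : V) :
    Complex.exp (-z) • v = w ↔ Complex.exp z • w = v := by
  rw [Complex.exp_neg, inv_smul_eq_iff₀ (Complex.exp_ne_zero z), eq_comm]

/-- Corollary 5.3: rotating a compatible triple of bases, or reversing it
together with the flags and the sign of `r`, again yields a compatible triple. -/
theorem compatibleTriple_rotate_and_reverse
    (d : ℕ) (hd : 2 ≤ d) (φ : ExtAlg d →ₗ[ℂ] ℂ) (hφ : IsTopIso φ)
    (F₁ F₂ F₃ : CompleteFlag d) (hF : GenPos ![F₁, F₂, F₃])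
    (r : ℂ) (hr : Complex.exp (3 * r) = ∏ j ∈ Bset d, tripleRatio φ F₁ F₂ F₃ j)
    (f g h : ℕ → (Fin d → ℂ)) :
    (CompatibleTriple F₁ F₂ F₃ r f g h ↔ CompatibleTriple F₂ F₃ F₁ r g h f) ∧
    (CompatibleTriple F₁ F₂ F₃ r f g h ↔
      CompatibleTriple F₃ F₂ F₁ (-r) (opFam d h) (opFam d g) (opFam d f)) := by
  obtain ⟨N, rfl⟩ : ∃ N, d = N + 2 := ⟨d - 2, by omega⟩
  have hE : Complex.exp (2 * r) ^ 3 = (∏ j ∈ Bset (N + 2), tripleRatio φ F₁ F₂ F₃ j) ^ 2 := by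
    rw [← hr, ← Complex.exp_nat_mul, ← Complex.exp_nat_mul]
    congr 1
    push_cast
    ring
  have hE0 := Complex.exp_ne_zero (2 * r)
  have hcycle : AdaptedBasis F₃ F₁ F₂ f → AdaptedBasis F₁ F₂ F₃ g → AdaptedBasis F₂ F₃ F₁ h →
      Complex.exp (2 * r) • g 1 = h (N + 2) →
      (Complex.exp (2 * r) • f 1 = g (N + 2) ↔ Complex.exp (2 * r) • h 1 = f (N + 2)) := by
    intro hf hg hh hgh
    obtain ⟨p₁, p₂, p₃, A₁, A₂, A₃, B₁, B₂, B₃, hp₁, hp₂, hp₃, hA₁, hA₂, hA₃, ef, eg', eg, eh', eh,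
      ef', hAB⟩ := exists_coords_of_adaptedBasis hφ hF hf hg hh
    rw [← hE] at hAB
    rw [eg, eh', smul_smul, smul_left_inj hp₁] at hgh
    rw [ef, eg', eh, ef', smul_smul, smul_smul, smul_left_inj hp₃, smul_left_inj hp₂]
    subst hgh
    constructor
    · rintro rfl
      refine mul_left_cancel₀ (mul_ne_zero (mul_ne_zero hE0 hE0) (mul_ne_zero hA₁ hA₃)) ?_
      linear_combination -hAB
    · rintro rfl
      refine mul_left_cancel₀ (mul_ne_zero (mul_ne_zero hE0 hE0) (mul_ne_zero hA₁ hA₂)) ?_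
      linear_combination -hAB
  constructor
  · constructor
    · rintro ⟨hf, hg, hh, hfg, hgh⟩
      exact ⟨hg, hh, hf, hgh, (hcycle hf hg hh hgh).mp hfg⟩
    · rintro ⟨hg, hh, hf, hgh, hhf⟩
      exact ⟨hf, hg, hh, (hcycle hf hg hh hgh).mpr hhf, hgh⟩
  · have hop1 : ∀ v : ℕ → (Fin (N + 2) → ℂ), opFam (N + 2) v 1 = v (N + 2) := fun v => rfl
    have hopd : ∀ v : ℕ → (Fin (N + 2) → ℂ), opFam (N + 2) v (N + 2) = v 1 := fun v =>
      congrArg v (by omega)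
    simp only [CompatibleTriple, adaptedBasis_opFam, hop1, hopd, mul_neg, exp_neg_smul_eq_iff]
    tauto
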